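/- The codes S_τ of length 16, where τ ranges over all permutations of the vectors of F^3 fixing 0, fall into exactly four isomorphism classes (with respect to the relation: S_τ ≅ S_{τ'} iff x + π(S_τ) = S_{τ'} for some x ∈ F^16 and permutation π), and these classes are characterized by the ranks of the codes, which take exactly the values 11, 12, 13 and 14. -/

import Mathlib

open Finset

/-- `V r` is the vector space `F^r` over `F = GF(2)`. -/
abbrev V (r : ℕ) : Type := Fin r → ZMod 2

/-- The point set of `SQS_τ` (and the coordinate set of codes of length `2^{r+1}`):
left-half points `({a},∅)` are `Sum.inl a`, right-half points `(∅,{a})` are `Sum.inr a`. -/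
abbrev Pt (r : ℕ) : Type := V r ⊕ V r

/-- Action of a coordinate permutation `π` on a word: `π(y)_i = y_{π⁻¹(i)}`. -/
def permAct {ι : Type} (π : Equiv.Perm ι) (y : ι → ZMod 2) : ι → ZMod 2 :=
  fun i => y (π.symm i)

/-- The extended Hamming code of length `2^r`, with coordinates indexed by the vectors
of `F^r`: all even weight words whose support sums to zero. -/
def extHamming (r : ℕ) : Set (V r → ZMod 2) :=
  {x | ∑ a : V r, x a • a = 0 ∧ ∑ a : V r, x a = 0}

/-- `e_a` : the weight-one word with support `{a}`. -/
def unitVec {r : ℕ} (a : V r) : V r → ZMod 2 :=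
  fun b => if b = a then 1 else 0

/-- The code `S_τ = ⋃_{a ∈ F^r} (H + e_a + e_0) × (H + e_{τ(a)} + e_0)` of length `2^{r+1}`. -/
def Scode {r : ℕ} (τ : Equiv.Perm (V r)) : Set (Pt r → ZMod 2) :=
  ⋃ a : V r, {z | ∃ h₁ ∈ extHamming r, ∃ h₂ ∈ extHamming r,
    z = Sum.elim (h₁ + unitVec a + unitVec 0) (h₂ + unitVec (τ a) + unitVec 0)}

/-- `Q_0` : quadruples `({a,b,c,d},∅)`, `a,b,c,d` pairwise distinct, `a+b+c+d=0`. -/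
def Q0 (r : ℕ) : Set (Finset (Pt r)) :=
  {q | ∃ a b c d : V r, a ≠ b ∧ a ≠ c ∧ a ≠ d ∧ b ≠ c ∧ b ≠ d ∧ c ≠ d ∧
    a + b + c + d = 0 ∧ q = {Sum.inl a, Sum.inl b, Sum.inl c, Sum.inl d}}

/-- `Q_1` : quadruples `(∅,{a,b,c,d})`, `a,b,c,d` pairwise distinct, `a+b+c+d=0`. -/
def Q1 (r : ℕ) : Set (Finset (Pt r)) :=
  {q | ∃ a b c d : V r, a ≠ b ∧ a ≠ c ∧ a ≠ d ∧ b ≠ c ∧ b ≠ d ∧ c ≠ d ∧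
    a + b + c + d = 0 ∧ q = {Sum.inr a, Sum.inr b, Sum.inr c, Sum.inr d}}

/-- `Q_τ` : quadruples `({a,c},{b,d})` with `τ(a+c) = b+d ≠ 0`. -/
def Qt {r : ℕ} (τ : Equiv.Perm (V r)) : Set (Finset (Pt r)) :=
  {q | ∃ a b c d : V r, τ (a + c) = b + d ∧ b + d ≠ 0 ∧
    q = {Sum.inl a, Sum.inl c, Sum.inr b, Sum.inr d}}

/-- The Steiner quadruple system `SQS_τ = Q_0 ∪ Q_1 ∪ Q_τ`. -/
def SQS {r : ℕ} (τ : Equiv.Perm (V r)) : Set (Finset (Pt r)) :=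
  Q0 r ∪ Q1 r ∪ Qt τ

/-- Action of a point bijection on a set system. -/
def qAct {α β : Type} [DecidableEq β] (π : α ≃ β) (Q : Set (Finset α)) : Set (Finset β) :=
  (fun q => q.image π) '' Q

/-- All quadruples of the system `Q` containing both points `p` and `p'`. -/
def quadsThrough {r : ℕ} (Q : Set (Finset (Pt r))) (p p' : Pt r) : Set (Finset (Pt r)) :=
  {q ∈ Q | p ∈ q ∧ p' ∈ q}

/-- The affine permutation `σ_{a,A} : b ↦ a + A b` of `F^r`, where `A ∈ GL(r,2)`. -/
def affEquiv {r : ℕ} (a : V r) (A : V r ≃ₗ[ZMod 2] V r) : Equiv.Perm (V r) :=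
  A.toEquiv.trans (Equiv.addLeft a)

/-- The permutation `ξ` swapping `({a},∅)` with `(∅,{a})` for every `a`. -/
def xi (r : ℕ) : Equiv.Perm (Pt r) := Equiv.sumComm (V r) (V r)

/-- Point transitivity of the Steiner quadruple system `SQS_τ`. -/
def SQSPointTransitive {r : ℕ} (τ : Equiv.Perm (V r)) : Prop :=
  ∀ p p' : Pt r, ∃ π : Equiv.Perm (Pt r), qAct π (SQS τ) = SQS τ ∧ π p = p'

/-- A code is transitive if (a subgroup of) its automorphism group acts transitively
on its codewords: any codeword is mapped to any other by an automorphism `y ↦ x + π(y)`. -/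
def IsTransitiveCode {ι : Type} (C : Set (ι → ZMod 2)) : Prop :=
  ∀ c ∈ C, ∀ c' ∈ C, ∃ (x : ι → ZMod 2) (π : Equiv.Perm ι),
    (fun y => x + permAct π y) '' C = C ∧ x + permAct π c = c'

/-- A code is coordinate transitive if `PAut(C)` acts transitively on coordinates. -/
def CoordTransitive {ι : Type} (C : Set (ι → ZMod 2)) : Prop :=
  ∀ i j : ι, ∃ π : Equiv.Perm ι, permAct π '' C = C ∧ π i = j

/-- `C_1` : the words at Hamming distance exactly 1 from the code `C`. -/
def codeNbrs {ι : Type} [Fintype ι] (C : Set (ι → ZMod 2)) : Set (ι → ZMod 2) :=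
  {y | y ∉ C ∧ ∃ c ∈ C, hammingDist y c = 1}

/-- A code is neighbor transitive if `Aut(C)` acts transitively both on `C` and on `C_1`. -/
def NeighborTransitive {ι : Type} [Fintype ι] (C : Set (ι → ZMod 2)) : Prop :=
  IsTransitiveCode C ∧
  ∀ y ∈ codeNbrs C, ∀ y' ∈ codeNbrs C, ∃ (x : ι → ZMod 2) (π : Equiv.Perm ι),
    (fun w => x + permAct π w) '' C = C ∧ x + permAct π y = y'

/-- An extended perfect code: minimum distance 4 and `2^n/(2n)` codewords. -/
def IsExtPerfect {ι : Type} [Fintype ι] (C : Set (ι → ZMod 2)) : Prop :=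
  (∀ x ∈ C, ∀ y ∈ C, x ≠ y → 4 ≤ hammingDist x y) ∧
  (∃ x ∈ C, ∃ y ∈ C, hammingDist x y = 4) ∧
  Nat.card C * (2 * Fintype.card ι) = 2 ^ Fintype.card ι

/-- The (extended) Mollard code `M(C,D)` with function `φ`. -/
def mollard {t m : ℕ} (C : Set (Fin t → ZMod 2)) (D : Set (Fin m → ZMod 2))
    (φ : (Fin t → ZMod 2) → (Fin m → ZMod 2)) : Set (Fin t × Fin m → ZMod 2) :=
  {z | (fun i => ∑ j, z (i, j)) ∈ C ∧
       ∃ d ∈ D, (fun j => ∑ i, z (i, j)) = φ (fun i => ∑ j, z (i, j)) + d}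

/-- Isomorphism of codes over possibly different coordinate sets:
`D = x + π(C)` for a coordinate bijection `π` and a vector `x`. -/
def CodeIso {ι κ : Type} (C : Set (ι → ZMod 2)) (D : Set (κ → ZMod 2)) : Prop :=
  ∃ (e : ι ≃ κ) (x : κ → ZMod 2), (fun z => x + fun k => z (e.symm k)) '' C = D

/-- The rank of a code: the dimension of its linear span. -/
noncomputable def codeRank {ι : Type} (C : Set (ι → ZMod 2)) : ℕ :=
  Module.finrank (ZMod 2) ↥(Submodule.span (ZMod 2) C)

/-- The kernel of a code: `{x : x + C = C}`. -/
def codeKernel {ι : Type} (C : Set (ι → ZMod 2)) : Set (ι → ZMod 2) :=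
  {x | (fun y => x + y) '' C = C}

/-- The dimension of the kernel of a code. -/
noncomputable def kernelDim {ι : Type} (C : Set (ι → ZMod 2)) : ℕ :=
  codeRank (codeKernel C)

/-- A permutation of `F^r` is affine if it is of the form `b ↦ a + A b`, `A ∈ GL(r,2)`. -/
def IsAffinePerm {r : ℕ} (g : Equiv.Perm (V r)) : Prop :=
  ∃ (a : V r) (A : V r ≃ₗ[ZMod 2] V r), ∀ x, g x = a + A x

/-- A regular subgroup of `GA(r,2)`: a subgroup consisting of affine permutations that
acts sharply transitively on `F^r`. -/
def IsRegularAffineSubgroup {r : ℕ} (G : Subgroup (Equiv.Perm (V r))) : Prop :=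
  (∀ g ∈ G, IsAffinePerm g) ∧ ∀ u v : V r, ∃! g : G, (g : Equiv.Perm (V r)) u = v

/-- `τ` is induced by an automorphism `T` of a regular subgroup `G ≤ GA(r,2)`:
`T(g_a) = g_{τ(a)}`, i.e. `τ(g(0)) = (T g)(0)` for every `g ∈ G`. -/
def InducedByRegularAut {r : ℕ} (τ : Equiv.Perm (V r)) : Prop :=
  ∃ G : Subgroup (Equiv.Perm (V r)), IsRegularAffineSubgroup G ∧
    ∃ T : G ≃* G, ∀ g : G, τ ((g : Equiv.Perm (V r)) 0) = (T g : Equiv.Perm (V r)) 0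

/-- The identification `F^{r+r'} ≃ F^r × F^{r'}`, `x|y ↦ (x,y)`. -/
def splitEquiv (r r' : ℕ) : V (r + r') ≃ V r × V r' :=
  (finSumFinEquiv.symm.arrowCongr (Equiv.refl (ZMod 2))).trans
    (Equiv.sumArrowEquivProdArrow _ _ _)

/-- The concatenation `τ|τ'` of permutations: `(τ|τ')(x|y) = τ(x)|τ'(y)`. -/
def concatPerm {r r' : ℕ} (τ : Equiv.Perm (V r)) (τ' : Equiv.Perm (V r')) :
    Equiv.Perm (V (r + r')) :=
  (splitEquiv r r').trans ((τ.prodCongr τ').trans (splitEquiv r r').symm)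


def eA : V 3 := ![1, 0, 0]
def eB : V 3 := ![0, 1, 0]
def eC : V 3 := ![0, 0, 1]

/-- The linear map with prescribed images of the standard basis. -/
def linFun (u v w x : V 3) : V 3 := x 0 • u + x 1 • v + x 2 • w

def linMap (u v w : V 3) : V 3 →ₗ[ZMod 2] V 3 where
  toFun := linFun u v w
  map_add' x y := by simp only [linFun, Pi.add_apply, add_smul]; abel
  map_smul' c x := by simp [linFun, mul_smul]

def Indep3 (u v w : V 3) : Prop :=
  u ≠ 0 ∧ v ≠ 0 ∧ u ≠ v ∧ w ≠ 0 ∧ u ≠ w ∧ v ≠ w ∧ u + v ≠ w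

instance (u v w : V 3) : Decidable (Indep3 u v w) := by unfold Indep3; infer_instance

theorem linFun_inj : ∀ u v w : V 3, Indep3 u v w → ∀ x, linFun u v w x = 0 → x = 0 := by
  decide +kernel

noncomputable def linEquiv (u v w : V 3) (h : Indep3 u v w) : V 3 ≃ₗ[ZMod 2] V 3 :=
  LinearEquiv.ofInjectiveEndo (linMap u v w) (by
    rw [← LinearMap.ker_eq_bot, LinearMap.ker_eq_bot']
    exact linFun_inj u v w h)

theorem linEquiv_apply (u v w : V 3) (h : Indep3 u v w) (x : V 3) :
    linEquiv u v w h x = linFun u v w x := rfl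

/-- Four representatives. -/
def rep : Fin 4 → Equiv.Perm (V 3)
  | 0 => 1
  | 1 => Equiv.swap ![1, 1, 0] ![1, 1, 1]
  | 2 => Equiv.swap ![1, 1, 0] ![1, 1, 1] * Equiv.swap ![1, 0, 1] ![1, 1, 1]
  | 3 => Equiv.swap ![1, 1, 0] ![1, 0, 1] * Equiv.swap ![1, 0, 1] ![0, 1, 1] *
          Equiv.swap ![0, 1, 1] ![1, 1, 1]

/-- Function given by its values at the nonzero points. -/
def tab (c3 c4 c5 c6 c7 : V 3) (x : V 3) : V 3 :=
  if x 0 = 0 then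
    if x 1 = 0 then (if x 2 = 0 then 0 else c4) else (if x 2 = 0 then eB else c6)
  else
    if x 1 = 0 then (if x 2 = 0 then eA else c5) else (if x 2 = 0 then c3 else c7)

def Good (f : V 3 → V 3) : Prop :=
  ∃ b1 : V 3, b1 ≠ 0 ∧ ∃ b2 : V 3, b2 ≠ 0 ∧ b1 ≠ b2 ∧ ∃ b3 : V 3, Indep3 b1 b2 b3 ∧
    ∃ i : Fin 4, ∀ x, f (linFun b1 b2 b3 x) = linFun (f b1) (f b2) (f b3) (rep i x)

instance (f : V 3 → V 3) : Decidable (Good f) := by unfold Good; infer_instance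

theorem good_one : ∀ c5 : V 3, c5 ∉ [0, eA, eB, eC, eA + eB] →
    ∀ c6 : V 3, c6 ∉ [0, eA, eB, eC, eA + eB, c5] →
    ∀ c7 : V 3, c7 ∉ [0, eA, eB, eC, eA + eB, c5, c6] →
    Good (tab (eA + eB) eC c5 c6 c7) := by
  decide +kernel

theorem good_two : ∀ c4 : V 3, c4 ∉ [0, eA, eB, eC] → ∀ c5 : V 3, c5 ∉ [0, eA, eB, eC, c4] →
    ∀ c6 : V 3, c6 ∉ [0, eA, eB, eC, c4, c5] →
    ∀ c7 : V 3, c7 ∉ [0, eA, eB, eC, c4, c5, c6] →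
    Good (tab eC c4 c5 c6 c7) := by
  decide +kernel

theorem tab_eq (τ : V 3 → V 3) (h0 : τ 0 = 0) (h1 : τ eA = eA) (h2 : τ eB = eB) :
    τ = tab (τ (eA + eB)) (τ eC) (τ (eA + eC)) (τ (eB + eC)) (τ (eA + eB + eC)) := by
  have key : ∀ x : V 3, x = 0 ∨ x = eA ∨ x = eB ∨ x = eA + eB ∨ x = eC ∨ x = eA + eC ∨
      x = eB + eC ∨ x = eA + eB + eC := by decide +kernel
  funext x
  rcases key x with h | h | h | h | h | h | h | h <;> subst h <;>
    simp [tab, eA, eB, eC] <;> assumption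

def Equ (τ τ' : Equiv.Perm (V 3)) : Prop :=
  ∃ A B : V 3 ≃ₗ[ZMod 2] V 3, ∀ x, A (τ (B x)) = τ' x

theorem good_equ (τ : Equiv.Perm (V 3)) (h : Good τ) : ∃ i, Equ τ (rep i) := by
  obtain ⟨b1, _, b2, _, _, b3, hI, i, h⟩ := h
  have hs : Function.Surjective (linMap (τ b1) (τ b2) (τ b3)) := by
    intro y
    obtain ⟨x, hx⟩ := (linEquiv b1 b2 b3 hI).surjective (τ.symm y)
    refine ⟨rep i x, ?_⟩
    have := h x
    rw [← linEquiv_apply _ _ _ hI, hx] at this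
    rw [Equiv.apply_symm_apply] at this
    exact this.symm
  have hi := LinearMap.injective_iff_surjective.2 hs
  refine ⟨i, (LinearEquiv.ofInjectiveEndo _ hi).symm, linEquiv b1 b2 b3 hI, fun x => ?_⟩
  rw [LinearEquiv.symm_apply_eq]
  exact h x

theorem exists_normal (τ : Equiv.Perm (V 3)) (h0 : τ 0 = 0) : ∃ A : V 3 ≃ₗ[ZMod 2] V 3,
    A (τ eA) = eA ∧ A (τ eB) = eB ∧
      ((A (τ (eA + eB)) = eA + eB ∧ A (τ eC) = eC) ∨ A (τ (eA + eB)) = eC) := by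
  have l1 : ∀ u v w, linFun u v w eA = u := by intro u v w; simp [linFun, eA]
  have l2 : ∀ u v w, linFun u v w eB = v := by intro u v w; simp [linFun, eB]
  have l3 : ∀ u v w, linFun u v w eC = w := by intro u v w; simp [linFun, eC]
  have ne : ∀ x y, x ≠ y → τ x ≠ τ y := fun x y h => τ.injective.ne h
  have nz : ∀ x, x ≠ 0 → τ x ≠ 0 := fun x h => h0 ▸ τ.injective.ne h
  by_cases hl : τ eA + τ eB = τ (eA + eB)
  · have hI : Indep3 (τ eA) (τ eB) (τ eC) := by
      refine ⟨nz _ (by decide), nz _ (by decide), ne _ _ (by decide), nz _ (by decide),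
        ne _ _ (by decide), ne _ _ (by decide), ?_⟩
      rw [hl]; exact ne _ _ (by decide)
    refine ⟨(linEquiv _ _ _ hI).symm, ?_, ?_, Or.inl ⟨?_, ?_⟩⟩
    · rw [LinearEquiv.symm_apply_eq, linEquiv_apply, l1]
    · rw [LinearEquiv.symm_apply_eq, linEquiv_apply, l2]
    · rw [LinearEquiv.symm_apply_eq, map_add (linEquiv _ _ _ hI), linEquiv_apply, linEquiv_apply,
        l1, l2, hl]
    · rw [LinearEquiv.symm_apply_eq, linEquiv_apply, l3]
  · have hI : Indep3 (τ eA) (τ eB) (τ (eA + eB)) :=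
      ⟨nz _ (by decide), nz _ (by decide), ne _ _ (by decide), nz _ (by decide),
        ne _ _ (by decide), ne _ _ (by decide), hl⟩
    refine ⟨(linEquiv _ _ _ hI).symm, ?_, ?_, Or.inr ?_⟩
    · rw [LinearEquiv.symm_apply_eq, linEquiv_apply, l1]
    · rw [LinearEquiv.symm_apply_eq, linEquiv_apply, l2]
    · rw [LinearEquiv.symm_apply_eq, linEquiv_apply, l3]

theorem exists_rep (τ : Equiv.Perm (V 3)) (h0 : τ 0 = 0) : ∃ i, Equ τ (rep i) := by
  obtain ⟨A, h1, h2, h3⟩ := exists_normal τ h0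
  let σ : Equiv.Perm (V 3) := τ.trans A.toEquiv
  have hσ : ∀ x, σ x = A (τ x) := fun _ => rfl
  have hσ0 : σ 0 = 0 := by rw [hσ, h0, map_zero]
  rw [← hσ] at h1 h2
  simp only [← hσ] at h3
  have hn : ∀ (x : V 3) (l l' : List (V 3)), l' = l.map σ → x ∉ l → σ x ∉ l' := by
    rintro x l _ rfl hx hm
    exact hx ((List.mem_map_of_injective σ.injective).1 hm)
  have hg : Good σ := by
    rw [tab_eq σ hσ0 h1 h2]
    rcases h3 with ⟨h3, h4⟩ | h3
    · rw [h3, h4]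
      apply good_one
      · exact hn _ [0, eA, eB, eC, eA + eB] _ (by simp only [List.map, hσ0, h1, h2, h3, h4])
          (by decide)
      · exact hn _ [0, eA, eB, eC, eA + eB, eA + eC] _
          (by simp only [List.map, hσ0, h1, h2, h3, h4]) (by decide)
      · exact hn _ [0, eA, eB, eC, eA + eB, eA + eC, eB + eC] _
          (by simp only [List.map, hσ0, h1, h2, h3, h4]) (by decide)
    · rw [h3]
      apply good_two
      · exact hn _ [0, eA, eB, eA + eB] _ (by simp only [List.map, hσ0, h1, h2, h3]) (by decide)
      · exact hn _ [0, eA, eB, eA + eB, eC] _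
          (by simp only [List.map, hσ0, h1, h2, h3]) (by decide)
      · exact hn _ [0, eA, eB, eA + eB, eC, eA + eC] _
          (by simp only [List.map, hσ0, h1, h2, h3]) (by decide)
      · exact hn _ [0, eA, eB, eA + eB, eC, eA + eC, eB + eC] _
          (by simp only [List.map, hσ0, h1, h2, h3]) (by decide)
  obtain ⟨i, A', B, h⟩ := good_equ σ hg
  exact ⟨i, A.trans A', B, fun x => h x⟩

/-- Syndrome and parity of a word. -/
def syn : (V 3 → ZMod 2) →ₗ[ZMod 2] V 3 × ZMod 2 where
  toFun x := (∑ a, x a • a, ∑ a, x a)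
  map_add' x y := by simp [add_smul, Finset.sum_add_distrib]
  map_smul' c x := by simp [mul_smul, Finset.smul_sum, Finset.mul_sum]

theorem syn_unit (a : V 3) : syn (unitVec a) = (a, 1) := by
  simp [syn, unitVec]

theorem mem_ext (x : V 3 → ZMod 2) : x ∈ extHamming 3 ↔ syn x = 0 := by
  simp [extHamming, syn, Prod.ext_iff]

theorem two_eq (x : V 3 → ZMod 2) : x + x = 0 := by
  funext i; exact CharTwo.add_self_eq_zero _

theorem mem_Scode (τ : Equiv.Perm (V 3)) (z : Pt 3 → ZMod 2) :
    z ∈ Scode τ ↔ ∃ a, syn (z ∘ Sum.inl) = (a, 0) ∧ syn (z ∘ Sum.inr) = (τ a, 0) := by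
  have one : (1 : ZMod 2) + 1 = 0 := by decide
  simp only [Scode, Set.mem_iUnion, Set.mem_ofPred_eq]
  refine exists_congr fun a => ⟨?_, ?_⟩
  · rintro ⟨h₁, H1, h₂, H2, rfl⟩
    rw [mem_ext] at H1 H2
    simp [Sum.elim_comp_inl, Sum.elim_comp_inr, map_add, H1, H2, syn_unit, one]
  · rintro ⟨H1, H2⟩
    have aux : ∀ (x : V 3 → ZMod 2) (b : V 3), syn x = (b, 0) →
        x + unitVec b + unitVec 0 ∈ extHamming 3 := by
      intro x b h
      rw [mem_ext, map_add, map_add, h, syn_unit, syn_unit]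
      ext <;> simp [one, CharTwo.add_self_eq_zero]
    have aux2 : ∀ (x : V 3 → ZMod 2) (b : V 3),
        x = x + unitVec b + unitVec 0 + unitVec b + unitVec 0 := by
      intro x b
      have : x + unitVec b + unitVec 0 + unitVec b + unitVec 0
        = x + (unitVec b + unitVec b) + (unitVec 0 + unitVec 0) := by abel
      rw [this, two_eq, two_eq, add_zero, add_zero]
    refine ⟨_, aux _ _ H1, _, aux _ _ H2, ?_⟩
    rw [← aux2, ← aux2]
    simp

theorem syn_perm (A : V 3 ≃ₗ[ZMod 2] V 3) (x : V 3 → ZMod 2) :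
    syn (fun b => x (A.symm b)) = (A (syn x).1, (syn x).2) := by
  ext1
  · simp only [syn, LinearMap.coe_mk, AddHom.coe_mk, map_sum, map_smul]
    rw [← A.toEquiv.sum_comp]
    simp
  · simp only [syn, LinearMap.coe_mk, AddHom.coe_mk]
    rw [← A.toEquiv.sum_comp]
    simp

theorem equ_iso (τ τ' : Equiv.Perm (V 3)) (h : Equ τ τ') :
    ∃ (x : Pt 3 → ZMod 2) (π : Equiv.Perm (Pt 3)),
      (fun y => x + permAct π y) '' Scode τ = Scode τ' := by
  obtain ⟨A, B, h⟩ := h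
  let π : Equiv.Perm (Pt 3) := Equiv.sumCongr B.symm.toEquiv A.toEquiv
  have key : ∀ y, permAct π y ∈ Scode τ' ↔ y ∈ Scode τ := by
    intro y
    have e1 : permAct π y ∘ Sum.inl = fun b => (y ∘ Sum.inl) (B.symm.symm b) := rfl
    have e2 : permAct π y ∘ Sum.inr = fun b => (y ∘ Sum.inr) (A.symm b) := rfl
    rw [mem_Scode, mem_Scode, e1, e2, syn_perm, syn_perm]
    refine Iff.trans ?_ B.toEquiv.exists_congr_right
    refine exists_congr fun a => ?_
    simp only [Prod.ext_iff, ← h, LinearEquiv.coe_toEquiv, LinearEquiv.symm_apply_eq,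
      EmbeddingLike.apply_eq_iff_eq]
  refine ⟨0, π, ?_⟩
  ext z
  simp only [zero_add, Set.mem_image]
  constructor
  · rintro ⟨y, hy, rfl⟩; exact (key y).2 hy
  · intro hz
    have : permAct π (permAct π.symm z) = z := by funext i; simp [permAct]
    exact ⟨permAct π.symm z, (key _).1 (this.symm ▸ hz), this⟩

def permLin (π : Equiv.Perm (Pt 3)) : (Pt 3 → ZMod 2) ≃ₗ[ZMod 2] (Pt 3 → ZMod 2) :=
  LinearEquiv.funCongrLeft (ZMod 2) (ZMod 2) π.symm

theorem zero_mem (τ : Equiv.Perm (V 3)) (h0 : τ 0 = 0) : (0 : Pt 3 → ZMod 2) ∈ Scode τ := by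
  rw [mem_Scode]
  refine ⟨0, ?_, ?_⟩
  · exact map_zero syn
  · rw [h0]; exact map_zero syn

theorem iso_rank (τ τ' : Equiv.Perm (V 3)) (h0 : τ 0 = 0) (h0' : τ' 0 = 0)
    (h : ∃ (x : Pt 3 → ZMod 2) (π : Equiv.Perm (Pt 3)),
      (fun y => x + permAct π y) '' Scode τ = Scode τ') :
    codeRank (Scode τ) = codeRank (Scode τ') := by
  obtain ⟨x, π, h⟩ := h
  have hp : ∀ y, permAct π y = permLin π y := fun _ => rfl
  have hx : x ∈ Scode τ' := by
    rw [← h]; exact ⟨0, zero_mem τ h0, by simp [hp]⟩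
  obtain ⟨s, hs, hs'⟩ : (0 : Pt 3 → ZMod 2) ∈ (fun y => x + permAct π y) '' Scode τ :=
    h ▸ zero_mem τ' h0'
  have hxs : x = permLin π s := by
    have : x + permLin π s = 0 := hs'
    have t : permLin π s + permLin π s = 0 := by
      funext i; exact CharTwo.add_self_eq_zero _
    exact add_right_cancel (this.trans t.symm)
  have hspan : Submodule.span (ZMod 2) (Scode τ') =
      (Submodule.span (ZMod 2) (Scode τ)).map (permLin π : _ →ₗ[ZMod 2] _) := by
    apply le_antisymm
    · rw [Submodule.span_le, ← h]
      rintro _ ⟨y, hy, rfl⟩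
      refine ⟨s + y, add_mem (Submodule.subset_span hs) (Submodule.subset_span hy), ?_⟩
      change permLin π (s + y) = x + permLin π y
      rw [map_add, hxs]
    · rw [Submodule.map_span, Submodule.span_le]
      rintro _ ⟨y, hy, rfl⟩
      have h1 : x + permLin π y ∈ Scode τ' := by rw [← h]; exact ⟨y, hy, rfl⟩
      have := sub_mem (Submodule.subset_span (R := ZMod 2) h1) (Submodule.subset_span hx)
      simpa using this
  unfold codeRank
  rw [hspan]
  exact (LinearEquiv.finrank_map_eq (permLin π) _).symm

/-- Both syndromes. -/
def Phi : (Pt 3 → ZMod 2) →ₗ[ZMod 2] (V 3 × ZMod 2) × (V 3 × ZMod 2) :=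
  LinearMap.prod (syn ∘ₗ LinearMap.funLeft _ _ Sum.inl) (syn ∘ₗ LinearMap.funLeft _ _ Sum.inr)

theorem syn_surj : Function.Surjective syn := by
  rintro ⟨a, c⟩
  refine ⟨unitVec a + (c + 1) • unitVec 0, ?_⟩
  rw [map_add, map_smul, syn_unit, syn_unit]
  ext1
  · simp
  · revert c; simp; decide

theorem Phi_surj : Function.Surjective Phi := by
  rintro ⟨p, q⟩
  obtain ⟨x, rfl⟩ := syn_surj p
  obtain ⟨y, rfl⟩ := syn_surj q
  exact ⟨Sum.elim x y, rfl⟩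

def gr (τ : Equiv.Perm (V 3)) (a : V 3) : (V 3 × ZMod 2) × (V 3 × ZMod 2) := ((a, 0), (τ a, 0))

theorem mem_Scode' (τ : Equiv.Perm (V 3)) (z : Pt 3 → ZMod 2) :
    z ∈ Scode τ ↔ ∃ a, gr τ a = Phi z := by
  rw [mem_Scode]
  refine exists_congr fun a => ?_
  have hz : Phi z = (syn (z ∘ Sum.inl), syn (z ∘ Sum.inr)) := rfl
  rw [hz, gr, eq_comm (b := (syn (z ∘ Sum.inl), syn (z ∘ Sum.inr)))]
  exact Prod.mk_inj.symm

theorem rank_formula (τ : Equiv.Perm (V 3)) (h0 : τ 0 = 0) : codeRank (Scode τ) =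
    8 + Module.finrank (ZMod 2) (Submodule.span (ZMod 2) (Set.range (gr τ))) := by
  set S := Submodule.span (ZMod 2) (Scode τ) with hS
  have hker : LinearMap.ker Phi ≤ S := by
    intro z hz
    refine Submodule.subset_span ((mem_Scode' τ z).2 ⟨0, ?_⟩)
    rw [LinearMap.mem_ker.1 hz, gr, h0]; rfl
  have hmap : S.map Phi = Submodule.span (ZMod 2) (Set.range (gr τ)) := by
    rw [hS, Submodule.map_span]
    congr 1
    ext p
    constructor
    · rintro ⟨z, hz, rfl⟩; exact (mem_Scode' τ z).1 hz
    · rintro ⟨a, rfl⟩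
      obtain ⟨z, hz⟩ := Phi_surj (gr τ a)
      exact ⟨z, (mem_Scode' τ z).2 ⟨a, hz.symm⟩, hz⟩
  have h1 := LinearMap.finrank_range_add_finrank_ker Phi
  have h2 := LinearMap.finrank_range_add_finrank_ker (Phi.domRestrict S)
  rw [LinearMap.range_eq_top.2 Phi_surj, finrank_top] at h1
  have e1 : LinearMap.range (Phi.domRestrict S) = S.map Phi := LinearMap.range_domRestrict _ _
  have e2 : Module.finrank (ZMod 2) (LinearMap.ker (Phi.domRestrict S)) =
      Module.finrank (ZMod 2) (LinearMap.ker Phi) := by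
    rw [LinearMap.ker_domRestrict]
    exact (Submodule.comapSubtypeEquivOfLe hker).finrank_eq
  rw [e1, e2, hmap] at h2
  have h3 : Module.finrank (ZMod 2) ((V 3 × ZMod 2) × (V 3 × ZMod 2)) = 8 := by
    simp [Module.finrank_prod]
  have h4 : Module.finrank (ZMod 2) (Pt 3 → ZMod 2) = 16 := by
    simp
  rw [h3, h4] at h1
  change Module.finrank (ZMod 2) S = _
  omega

theorem finrank_aux {n : ℕ} (τ : Equiv.Perm (V 3)) (p : Fin n → V 3)
    (hli : ∀ g : Fin n → ZMod 2, ∑ i, g i • gr τ (p i) = 0 → ∀ i, g i = 0)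
    (hsp : ∀ a, ∃ g : Fin n → ZMod 2, ∑ i, g i • gr τ (p i) = gr τ a) :
    Module.finrank (ZMod 2) (Submodule.span (ZMod 2) (Set.range (gr τ))) = n := by
  have hl : LinearIndependent (ZMod 2) (fun i => gr τ (p i)) := Fintype.linearIndependent_iff.2 hli
  have := finrank_span_eq_card hl
  rw [Fintype.card_fin] at this
  suffices hE : Submodule.span (ZMod 2) (Set.range (gr τ)) =
      Submodule.span (ZMod 2) (Set.range fun i => gr τ (p i)) by rw [hE, this]
  apply le_antisymm
  · rw [Submodule.span_le]
    rintro _ ⟨a, rfl⟩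
    obtain ⟨g, hg⟩ := hsp a
    rw [← hg]
    exact Submodule.sum_mem _ fun i _ => Submodule.smul_mem _ _ (Submodule.subset_span ⟨i, rfl⟩)
  · apply Submodule.span_mono
    rintro _ ⟨i, rfl⟩
    exact ⟨p i, rfl⟩

theorem rep_zero : ∀ i, rep i 0 = 0 := by decide +kernel

theorem rank_rep : ∀ i : Fin 4, codeRank (Scode (rep i)) = 11 + i := by
  intro i
  rw [rank_formula _ (rep_zero i)]
  fin_cases i
  · have := finrank_aux (rep 0) ![eA, eB, eC] (by decide +kernel) (by decide +kernel)
    simp [this]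
  · have := finrank_aux (rep 1) ![eA, eB, eC, ![1, 1, 0]] (by decide +kernel) (by decide +kernel)
    simp [this]
  · have := finrank_aux (rep 2) ![eA, eB, eC, ![1, 1, 0], ![1, 0, 1]]
      (by decide +kernel) (by decide +kernel)
    simp [this]
  · have := finrank_aux (rep 3) ![eA, eB, eC, ![1, 1, 0], ![1, 0, 1], ![0, 1, 1]]
      (by decide +kernel) (by decide +kernel)
    simp [this]

theorem Equ.symm {τ τ' : Equiv.Perm (V 3)} (h : Equ τ τ') : Equ τ' τ := by
  obtain ⟨A, B, h⟩ := h
  exact ⟨A.symm, B.symm, fun x => by simp [← h]⟩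

theorem Equ.trans {τ τ' τ'' : Equiv.Perm (V 3)} (h : Equ τ τ') (h' : Equ τ' τ'') : Equ τ τ'' := by
  obtain ⟨A, B, h⟩ := h
  obtain ⟨A', B', h'⟩ := h'
  exact ⟨A.trans A', B'.trans B, fun x => by simp [← h', ← h]⟩

theorem rank_of_equ {τ : Equiv.Perm (V 3)} (h0 : τ 0 = 0) {i : Fin 4} (h : Equ τ (rep i)) :
    codeRank (Scode τ) = 11 + i :=
  (iso_rank _ _ h0 (rep_zero i) (equ_iso _ _ h)).trans (rank_rep i)

/-- the codes `S_τ` of length 16 (over all permutations `τ` of `F^3`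
fixing `0`) fall into exactly four isomorphism classes, characterized by their ranks,
which take exactly the values 11, 12, 13 and 14. -/
theorem Scode_length16_four_classes :
    (∀ τ τ' : Equiv.Perm (V 3), τ 0 = 0 → τ' 0 = 0 →
      ((∃ (x : Pt 3 → ZMod 2) (π : Equiv.Perm (Pt 3)),
          (fun y => x + permAct π y) '' Scode τ = Scode τ') ↔
        codeRank (Scode τ) = codeRank (Scode τ'))) ∧
    (∀ τ : Equiv.Perm (V 3), τ 0 = 0 →
      codeRank (Scode τ) ∈ ({11, 12, 13, 14} : Set ℕ)) ∧
    (∀ k ∈ ({11, 12, 13, 14} : Set ℕ),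
      ∃ τ : Equiv.Perm (V 3), τ 0 = 0 ∧ codeRank (Scode τ) = k) := by
  refine ⟨fun τ τ' h0 h0' => ⟨iso_rank τ τ' h0 h0', fun h => ?_⟩, fun τ h0 => ?_, fun k hk => ?_⟩
  · obtain ⟨i, hi⟩ := exists_rep τ h0
    obtain ⟨j, hj⟩ := exists_rep τ' h0'
    rw [rank_of_equ h0 hi, rank_of_equ h0' hj] at h
    have : i = j := by ext; omega
    subst this
    exact equ_iso _ _ (hi.trans hj.symm)
  · obtain ⟨i, hi⟩ := exists_rep τ h0
    rw [rank_of_equ h0 hi]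
    fin_cases i <;> simp
  · simp only [Set.mem_insert_iff, Set.mem_singleton_iff] at hk
    rcases hk with rfl | rfl | rfl | rfl
    · exact ⟨rep 0, rep_zero 0, rank_rep 0⟩
    · exact ⟨rep 1, rep_zero 1, rank_rep 1⟩
    · exact ⟨rep 2, rep_zero 2, rank_rep 2⟩
    · exact ⟨rep 3, rep_zero 3, rank_rep 3⟩
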